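/- arXiv:2507.17935 — 5 statements merged into one kernel-verified Lean document; each statement's English description precedes it below -/
import Mathlib

section
/- Let 0 → U → M → N → 0 be a short exact sequence of finitely generated ℤ^n-graded S-modules. Then slength(M) ≤ slength(U) + slength(N). -/
open MvPolynomial

/-- A `ℤⁿ`-multigrading on a module `M` over the polynomial ring
`S = K[x_1,…,x_n]`: a direct sum decomposition of `M` into `K`-subspaces,
indexed by `ℤⁿ`, compatible with the natural multigrading of `S` (multiplying
by a monomial of exponent `d` shifts degrees by `d`). -/
structure Multigrading (K : Type) [Field K] (n : ℕ) (M : Type) [AddCommGroup M]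
    [Module (MvPolynomial (Fin n) K) M] [Module K M]
    [IsScalarTower K (MvPolynomial (Fin n) K) M] where
  grading : (Fin n →₀ ℤ) → Submodule K M
  internal : DirectSum.IsInternal grading
  monomial_smul_mem : ∀ (d : Fin n →₀ ℕ) (a : Fin n →₀ ℤ) (x : M), x ∈ grading a →
    (monomial d (1 : K) : MvPolynomial (Fin n) K) • x ∈
      grading (a + d.mapRange (Nat.cast : ℕ → ℤ) Nat.cast_zero)

/-- The Stanley subspace `x K[Z]` of `M`: the `K`-span of the elements
`x^d • x` with `d` supported in `Z`. -/
def stanleySub {K : Type} [Field K] {n : ℕ} {M : Type} [AddCommGroup M]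
    [Module (MvPolynomial (Fin n) K) M] [Module K M]
    [IsScalarTower K (MvPolynomial (Fin n) K) M] (x : M) (Z : Set (Fin n)) :
    Submodule K M :=
  Submodule.span K
    ((fun d : Fin n →₀ ℕ => (monomial d (1 : K) : MvPolynomial (Fin n) K) • x) ''
      {d | ↑d.support ⊆ Z})

/-- A Stanley decomposition of a multigraded module `M`: a finite family of
homogeneous elements `x_i` and sets of variables `Z_i` such that
`M = ⊕ᵢ x_i K[Z_i]` as `K`-vector spaces, each `x_i K[Z_i]` being a free
`K[Z_i]`-module (equivalently, the monomial multiples of `x_i` by monomials in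
the variables of `Z_i` are `K`-linearly independent). -/
structure StanleyDecomp {K : Type} [Field K] {n : ℕ} {M : Type} [AddCommGroup M]
    [Module (MvPolynomial (Fin n) K) M] [Module K M]
    [IsScalarTower K (MvPolynomial (Fin n) K) M] (g : Multigrading K n M) where
  r : ℕ
  elem : Fin r → M
  vars : Fin r → Set (Fin n)
  homog : ∀ i, ∃ a, elem i ∈ g.grading a
  free : ∀ i, LinearIndependent K
    (fun d : {d : Fin n →₀ ℕ // ↑d.support ⊆ vars i} =>
      (monomial d.1 (1 : K) : MvPolynomial (Fin n) K) • elem i)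
  internal : DirectSum.IsInternal (fun i : Fin r => stanleySub (K := K) (elem i) (vars i))

/-- The Stanley length of a multigraded module: the minimal length of a
Stanley decomposition. -/
noncomputable def slengthMod {K : Type} [Field K] {n : ℕ} {M : Type} [AddCommGroup M]
    [Module (MvPolynomial (Fin n) K) M] [Module K M]
    [IsScalarTower K (MvPolynomial (Fin n) K) M] (g : Multigrading K n M) : ℕ :=
  sInf {r | ∃ D : StanleyDecomp g, D.r = r}

theorem tsub_single_add_single {n : ℕ} {d : Fin n →₀ ℕ} {j : Fin n} (hj : j ∈ d.support) :
    d - Finsupp.single j 1 + Finsupp.single j 1 = d :=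
  tsub_add_cancel_of_le (Finsupp.single_le_iff.mpr
    (Nat.one_le_iff_ne_zero.mpr (Finsupp.mem_support_iff.mp hj)))

theorem monomial_smul_mem_of_single_smul_mem {K : Type} [Field K] {n : ℕ} {M : Type} [AddCommGroup M]
    [Module (MvPolynomial (Fin n) K) M]
    (W : Submodule (MvPolynomial (Fin n) K) M) {x : M}
    {d : Fin n →₀ ℕ} {j : Fin n} (hj : j ∈ d.support)
    (hx : (X j : MvPolynomial (Fin n) K) • x ∈ W) :
    (monomial d (1 : K) : MvPolynomial (Fin n) K) • x ∈ W := by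
  rw [← tsub_single_add_single hj, ← mul_one (1 : K), ← monomial_mul, mul_smul]
  exact W.smul_mem _ hx

/-- If no variable in `Z` changes the colon ideal of `x ∉ W`, then no monomial in the variables
of `Z` multiplies `x` into `W`. -/
theorem monomial_smul_notMem {K : Type} [Field K] {n : ℕ} {M : Type} [AddCommGroup M]
    [Module (MvPolynomial (Fin n) K) M]
    (W : Submodule (MvPolynomial (Fin n) K) M) {x : M} (hx : x ∉ W)
    {Z : Set (Fin n)}
    (hZ : ∀ j ∈ Z, ∀ p : MvPolynomial (Fin n) K, p • (X j : MvPolynomial (Fin n) K) • x ∈ W →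
      p • x ∈ W)
    (d : Fin n →₀ ℕ) (hd : ↑d.support ⊆ Z) :
    (monomial d (1 : K) : MvPolynomial (Fin n) K) • x ∉ W := by
  induction d using WellFoundedLT.induction with
  | ind d ih =>
    rcases eq_or_ne d 0 with rfl | hd0
    · rwa [← C_apply, map_one, one_smul]
    · obtain ⟨j, hj⟩ := Finsupp.support_nonempty_iff.mpr hd0
      have hsplit : d - Finsupp.single j 1 + Finsupp.single j 1 = d :=
        tsub_single_add_single hj
      have hlt : d - Finsupp.single j 1 < d := by
        refine lt_of_le_of_ne tsub_le_self fun h => ?_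
        rw [h] at hsplit
        simp at hsplit
      intro hmem
      refine ih _ hlt ((Finset.coe_subset.mpr Finsupp.support_tsub).trans hd)
        (hZ j (hd hj) _ ?_)
      rwa [X, ← mul_smul, monomial_mul, hsplit, mul_one]

section StanleyFamilies

variable {K : Type} [Field K] {n : ℕ} {M : Type} [AddCommGroup M]
  [Module (MvPolynomial (Fin n) K) M] [Module K M]
  [IsScalarTower K (MvPolynomial (Fin n) K) M]

/-- The projection of a multigraded module onto its component of degree `a`. -/
noncomputable def Multigrading.proj (g : Multigrading K n M) (a : Fin n →₀ ℤ) : M →ₗ[K] M :=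
  (g.grading a).subtype ∘ₗ DirectSum.component K _ (fun b => g.grading b) a ∘ₗ
    (LinearEquiv.ofBijective (DirectSum.coeLinearMap g.grading) g.internal).symm.toLinearMap

theorem Multigrading.proj_mem (g : Multigrading K n M) (a : Fin n →₀ ℤ) (m : M) :
    g.proj a m ∈ g.grading a :=
  Subtype.prop _

theorem Multigrading.proj_of_mem (g : Multigrading K n M) {a : Fin n →₀ ℤ} {m : M}
    (hm : m ∈ g.grading a) : g.proj a m = m :=
  congrArg Subtype.val (g.internal.ofBijective_coeLinearMap_of_mem hm)

theorem Multigrading.proj_of_mem_ne (g : Multigrading K n M) {a b : Fin n →₀ ℤ} {m : M}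
    (hm : m ∈ g.grading a) (hab : a ≠ b) : g.proj b m = 0 :=
  congrArg Subtype.val (g.internal.ofBijective_coeLinearMap_of_mem_ne hab hm)

theorem Multigrading.exists_homogeneous_notMem (g : Multigrading K n M) {W : Submodule K M}
    (hW : W ≠ ⊤) : ∃ (a : Fin n →₀ ℤ) (m : M), m ∈ g.grading a ∧ m ∉ W := by
  by_contra! h
  exact hW (top_le_iff.mp (g.internal.submodule_iSup_eq_top ▸ iSup_le fun a m hm => h a m hm))

/-- A degree-preserving linear map commutes with the projections onto components. -/
theorem Multigrading.map_proj {N : Type} [AddCommGroup N]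
    [Module (MvPolynomial (Fin n) K) N] [Module K N]
    [IsScalarTower K (MvPolynomial (Fin n) K) N]
    (gM : Multigrading K n M) (gN : Multigrading K n N) (φ : M →ₗ[K] N)
    (hφ : ∀ (a : Fin n →₀ ℤ) (m : M), m ∈ gM.grading a → φ m ∈ gN.grading a)
    (a : Fin n →₀ ℤ) (m : M) : φ (gM.proj a m) = gN.proj a (φ m) := by
  have hm : m ∈ ⨆ b, gM.grading b := by
    rw [gM.internal.submodule_iSup_eq_top]
    exact Submodule.mem_top
  induction hm using Submodule.iSup_induction' with
  | mem b m hm =>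
    rcases eq_or_ne b a with rfl | hab
    · rw [gM.proj_of_mem hm, gN.proj_of_mem (hφ _ _ hm)]
    · rw [gM.proj_of_mem_ne hm hab, gN.proj_of_mem_ne (hφ _ _ hm) hab, map_zero]
  | zero => simp
  | add x y _ _ hx hy => simp only [map_add, hx, hy]

/-- The shift of multidegrees by exponents of monomials is injective. -/
theorem add_mapRange_natCast_injective (a : Fin n →₀ ℤ) :
    Function.Injective fun d : Fin n →₀ ℕ =>
      a + d.mapRange (Nat.cast : ℕ → ℤ) Nat.cast_zero :=
  (add_right_injective a).comp (Finsupp.mapRange_injective _ Nat.cast_zero Nat.cast_injective)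

/-- A subspace spanned by homogeneous elements contains the components of its elements. -/
theorem Multigrading.proj_mem_span (g : Multigrading K n M) {ι : Type} {v : ι → M}
    (hv : ∀ i, ∃ a, v i ∈ g.grading a) (b : Fin n →₀ ℤ) {m : M}
    (hm : m ∈ Submodule.span K (Set.range v)) :
    g.proj b m ∈ Submodule.span K (Set.range v) := by
  induction hm using Submodule.span_induction with
  | mem m hm =>
    obtain ⟨i, rfl⟩ := hm
    obtain ⟨a, ha⟩ := hv i
    rcases eq_or_ne a b with rfl | hab
    · rw [g.proj_of_mem ha]
      exact Submodule.subset_span ⟨i, rfl⟩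
    · rw [g.proj_of_mem_ne ha hab]
      exact Submodule.zero_mem _
  | zero => simp
  | add x y _ _ hx hy => rw [map_add]; exact Submodule.add_mem _ hx hy
  | smul c x _ hx => rw [map_smul]; exact Submodule.smul_mem _ c hx

/-- Homogeneous elements of distinct degrees outside a homogeneous subspace `W` are linearly
independent modulo `W`. -/
theorem Multigrading.linearIndependent_mkQ (g : Multigrading K n M) {W : Submodule K M}
    (hW : ∀ b, ∀ m ∈ W, g.proj b m ∈ W) {ι : Type} {v : ι → M} {deg : ι → Fin n →₀ ℤ}
    (hdeg : Function.Injective deg) (hv : ∀ i, v i ∈ g.grading (deg i)) (hvW : ∀ i, v i ∉ W) :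
    LinearIndependent K (W.mkQ ∘ v) := by
  rw [linearIndependent_iff']
  intro s c hsum i hi
  have hmem : ∑ j ∈ s, c j • v j ∈ W := by
    rw [← Submodule.ker_mkQ W, LinearMap.mem_ker, map_sum]
    simpa using hsum
  have hproj : g.proj (deg i) (∑ j ∈ s, c j • v j) = c i • v i := by
    rw [map_sum, Finset.sum_eq_single i]
    · rw [map_smul, g.proj_of_mem (hv i)]
    · intro j _ hji
      rw [map_smul, g.proj_of_mem_ne (hv j) (hdeg.ne hji), smul_zero]
    · exact fun h => absurd hi h
  by_contra hci
  have h := hW (deg i) _ hmem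
  rw [hproj] at h
  exact hvW i ((W.smul_mem_iff hci).mp h)

/-- All the monomial multiples `x^d • x_i` with `d` supported in `Z_i`. -/
noncomputable def stanleyFamily {ι : Type} (x : ι → M) (Z : ι → Set (Fin n))
    (p : Σ i, {d : Fin n →₀ ℕ // ↑d.support ⊆ Z i}) : M :=
  (monomial p.2.1 (1 : K) : MvPolynomial (Fin n) K) • x p.1

/-- The family of pairs `(x_i, Z_i)` is a Stanley decomposition of the subspace `W`, stated
in terms of a basis of `W` by monomial multiples. -/
structure IsStanleyFamily (g : Multigrading K n M) {ι : Type} (x : ι → M)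
    (Z : ι → Set (Fin n)) (W : Submodule K M) : Prop where
  homog : ∀ i, ∃ a, x i ∈ g.grading a
  linearIndependent : LinearIndependent K (stanleyFamily (K := K) x Z)
  span_eq : Submodule.span K (Set.range (stanleyFamily (K := K) x Z)) = W

theorem stanleySub_eq_span_range (x : M) (Z : Set (Fin n)) :
    stanleySub (K := K) x Z = Submodule.span K
      (Set.range fun d : {d : Fin n →₀ ℕ // ↑d.support ⊆ Z} =>
        (monomial d.1 (1 : K) : MvPolynomial (Fin n) K) • x) := by
  rw [stanleySub, Set.image_eq_range]
  rfl

theorem span_range_stanleyFamily {ι : Type} (x : ι → M) (Z : ι → Set (Fin n)) :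
    Submodule.span K (Set.range (stanleyFamily (K := K) x Z)) =
      ⨆ i, stanleySub (K := K) (x i) (Z i) := by
  rw [Set.range_sigma_eq_iUnion_range, Submodule.span_iUnion]
  simp only [stanleySub_eq_span_range]
  rfl

theorem stanleyFamily_homogeneous (g : Multigrading K n M) {ι : Type} {x : ι → M}
    (hx : ∀ i, ∃ a, x i ∈ g.grading a) (Z : ι → Set (Fin n))
    (p : Σ i, {d : Fin n →₀ ℕ // ↑d.support ⊆ Z i}) :
    ∃ a, stanleyFamily (K := K) x Z p ∈ g.grading a :=
  (hx p.1).imp' _ fun a ha => g.monomial_smul_mem p.2.1 a _ ha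

theorem StanleyDecomp.isStanleyFamily {g : Multigrading K n M} (D : StanleyDecomp g) :
    IsStanleyFamily g D.elem D.vars ⊤ where
  homog := D.homog
  linearIndependent := by
    let b : ∀ i, Module.Basis {d : Fin n →₀ ℕ // ↑d.support ⊆ D.vars i} K
        (stanleySub (K := K) (D.elem i) (D.vars i)) := fun i =>
      (Module.Basis.span (D.free i)).map
        (LinearEquiv.ofEq _ _ (stanleySub_eq_span_range (D.elem i) (D.vars i)).symm)
    convert (D.internal.collectedBasis b).linearIndependent using 1
    funext p
    simp [b, stanleyFamily, DirectSum.IsInternal.collectedBasis_coe, Module.Basis.span_apply]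
  span_eq := by
    rw [span_range_stanleyFamily, D.internal.submodule_iSup_eq_top]

theorem IsStanleyFamily.reindex {g : Multigrading K n M} {ι κ : Type} {x : ι → M}
    {Z : ι → Set (Fin n)} {W : Submodule K M} (h : IsStanleyFamily g x Z W) (e : κ ≃ ι) :
    IsStanleyFamily g (x ∘ e) (Z ∘ e) W := by
  let E : (Σ k, {d : Fin n →₀ ℕ // ↑d.support ⊆ (Z ∘ e) k}) ≃
      Σ i, {d : Fin n →₀ ℕ // ↑d.support ⊆ Z i} :=
    Equiv.sigmaCongrLeft (β := fun i => {d : Fin n →₀ ℕ // ↑d.support ⊆ Z i}) e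
  have hE : stanleyFamily (K := K) (x ∘ e) (Z ∘ e) = stanleyFamily (K := K) x Z ∘ E := rfl
  refine ⟨fun i => h.homog (e i), ?_, ?_⟩
  · rw [hE]
    exact h.linearIndependent.comp _ E.injective
  · rw [hE, E.surjective.range_comp, h.span_eq]

theorem IsStanleyFamily.isInternal {g : Multigrading K n M} {ι : Type} [DecidableEq ι]
    {x : ι → M} {Z : ι → Set (Fin n)} (h : IsStanleyFamily g x Z ⊤) :
    DirectSum.IsInternal fun i => stanleySub (K := K) (x i) (Z i) := by
  refine DirectSum.isInternal_submodule_of_iSupIndep_of_iSup_eq_top ?_ ?_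
  · rw [iSupIndep_def]
    intro i
    refine (h.linearIndependent.disjoint_span_image
      (s := {p | p.1 = i}) (t := {p | p.1 ≠ i}) ?_).mono ?_ ?_
    · exact Set.disjoint_left.mpr fun p hp hp' => hp' hp
    · rw [stanleySub_eq_span_range]
      refine Submodule.span_mono ?_
      rintro _ ⟨d, rfl⟩
      exact ⟨⟨i, d⟩, rfl, rfl⟩
    · refine iSup₂_le fun j hj => ?_
      rw [stanleySub_eq_span_range]
      refine Submodule.span_mono ?_
      rintro _ ⟨d, rfl⟩
      exact ⟨⟨j, d⟩, hj, rfl⟩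
  · rw [← span_range_stanleyFamily, h.span_eq]

theorem IsStanleyFamily.exists_stanleyDecomp {g : Multigrading K n M} {ι : Type} [Fintype ι]
    {x : ι → M} {Z : ι → Set (Fin n)} (h : IsStanleyFamily g x Z ⊤) :
    ∃ D : StanleyDecomp g, D.r = Fintype.card ι := by
  have h' := h.reindex (Fintype.equivFin ι).symm
  have hfree := fun i => h'.linearIndependent.comp (Sigma.mk i) sigma_mk_injective
  exact ⟨⟨Fintype.card ι, _, _, h'.homog, hfree, h'.isInternal⟩, rfl⟩

/-- A Stanley family of `W` extends by any homogeneous family whose monomial multiples are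
linearly independent modulo `W`. -/
theorem IsStanleyFamily.sumElim {g : Multigrading K n M} {ι κ : Type} {x : ι → M}
    {Z : ι → Set (Fin n)} {W : Submodule K M} (h : IsStanleyFamily g x Z W)
    {y : κ → M} {Y : κ → Set (Fin n)} (hy : ∀ k, ∃ a, y k ∈ g.grading a)
    (hli : LinearIndependent K (W.mkQ ∘ stanleyFamily (K := K) y Y)) :
    IsStanleyFamily g (Sum.elim x y) (Sum.elim Z Y)
      (W ⊔ Submodule.span K (Set.range (stanleyFamily (K := K) y Y))) := by
  let E : (Σ i, {d : Fin n →₀ ℕ // ↑d.support ⊆ Sum.elim Z Y i}) ≃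
      (Σ i, {d : Fin n →₀ ℕ // ↑d.support ⊆ Z i}) ⊕
        Σ k, {d : Fin n →₀ ℕ // ↑d.support ⊆ Y k} :=
    Equiv.sumSigmaDistrib fun i => {d : Fin n →₀ ℕ // ↑d.support ⊆ Sum.elim Z Y i}
  have hE : stanleyFamily (K := K) (Sum.elim x y) (Sum.elim Z Y) =
      Sum.elim (stanleyFamily (K := K) x Z) (stanleyFamily (K := K) y Y) ∘ E := by
    funext ⟨i, d⟩
    cases i <;> rfl
  have hmem : ∀ p, stanleyFamily (K := K) x Z p ∈ W := fun p =>
    h.span_eq ▸ Submodule.subset_span ⟨p, rfl⟩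
  refine ⟨?_, ?_, ?_⟩
  · rintro (i | k)
    exacts [h.homog i, hy k]
  · rw [hE]
    have hW : LinearIndependent K fun p => (⟨stanleyFamily (K := K) x Z p, hmem p⟩ : W) :=
      LinearIndependent.of_comp W.subtype h.linearIndependent
    exact (hW.sumElim_of_quotient _ hli).comp _ E.injective
  · rw [hE, E.surjective.range_comp, Set.Sum.elim_range, Submodule.span_union, h.span_eq]

/-- A finitely generated multigraded module has a finite Stanley family. -/
theorem exists_isStanleyFamily [Module.Finite (MvPolynomial (Fin n) K) M]
    (g : Multigrading K n M) :
    ∃ (r : ℕ) (x : Fin r → M) (Z : Fin r → Set (Fin n)), IsStanleyFamily g x Z ⊤ := by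
  let P : Set (Submodule (MvPolynomial (Fin n) K) M) := {W |
    ∃ (r : ℕ) (x : Fin r → M) (Z : Fin r → Set (Fin n)),
      IsStanleyFamily g x Z (W.restrictScalars K)}
  have hP : P.Nonempty := by
    refine ⟨⊥, 0, Fin.elim0, Fin.elim0, fun i => i.elim0, linearIndependent_empty_type, ?_⟩
    simp [Set.range_eq_empty]
  have hN : IsNoetherian (MvPolynomial (Fin n) K) M := inferInstance
  obtain ⟨W, ⟨r, x, Z, hW⟩, hmax⟩ := set_has_maximal_iff_noetherian.mpr hN P hP
  by_cases htop : W = ⊤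
  · subst htop
    exact ⟨r, x, Z, hW⟩
  exfalso
  let Q : Set (Ideal (MvPolynomial (Fin n) K)) := {I | ∃ (a : Fin n →₀ ℤ) (m : M),
    m ∈ g.grading a ∧ m ∉ W ∧
      I = W.comap (LinearMap.toSpanSingleton (MvPolynomial (Fin n) K) M m)}
  have hQ : Q.Nonempty := by
    obtain ⟨a, m, ha, hm⟩ := g.exists_homogeneous_notMem (W := W.restrictScalars K)
      (by simpa using htop)
    exact ⟨_, a, m, ha, hm, rfl⟩
  obtain ⟨_, ⟨a, m, ha, hm, rfl⟩, hQmax⟩ := set_has_maximal_iff_noetherian.mpr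
    (inferInstanceAs (IsNoetherian (MvPolynomial (Fin n) K) (MvPolynomial (Fin n) K))) Q hQ
  let Y : Set (Fin n) := {j | (X j : MvPolynomial (Fin n) K) • m ∉ W}
  have hY : ∀ j ∈ Y, ∀ p : MvPolynomial (Fin n) K,
      p • (X j : MvPolynomial (Fin n) K) • m ∈ W → p • m ∈ W := by
    intro j hj p hp
    by_contra hpm
    refine hQmax _ ⟨_, _, g.monomial_smul_mem (Finsupp.single j 1) a m ha, hj, rfl⟩ ?_
    refine SetLike.lt_iff_le_and_exists.mpr ⟨fun q hq => ?_, p, hp, hpm⟩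
    change q • (X j : MvPolynomial (Fin n) K) • m ∈ W
    rw [smul_comm]
    exact W.smul_mem _ hq
  let y : Unit → M := fun _ => m
  have hy : ∀ k, ∃ a, y k ∈ g.grading a := fun _ => ⟨a, ha⟩
  have hli : LinearIndependent K
      ((W.restrictScalars K).mkQ ∘ stanleyFamily (K := K) y fun _ => Y) := by
    refine g.linearIndependent_mkQ (W := W.restrictScalars K) ?_
      (deg := fun p => a + p.2.1.mapRange (Nat.cast : ℕ → ℤ) Nat.cast_zero) ?_
      (fun p => g.monomial_smul_mem _ _ _ ha)
      (fun p => monomial_smul_notMem W hm hY p.2.1 p.2.2)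
    · rw [← hW.span_eq]
      exact fun b m hm => g.proj_mem_span (stanleyFamily_homogeneous g hW.homog Z) b hm
    · rintro ⟨⟨⟩, d⟩ ⟨⟨⟩, d'⟩ h
      exact congrArg _ (Subtype.ext (add_mapRange_natCast_injective a h))
  have hsum := hW.sumElim hy hli
  have hrestrict : W.restrictScalars K ⊔ Submodule.span K
      (Set.range (stanleyFamily (K := K) y fun _ => Y)) =
      (W ⊔ Submodule.span (MvPolynomial (Fin n) K) {m}).restrictScalars K := by
    apply le_antisymm
    · refine sup_le (fun w hw => Submodule.mem_sup_left (show w ∈ W from hw))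
        (Submodule.span_le.mpr ?_)
      rintro _ ⟨p, rfl⟩
      exact Submodule.mem_sup_right (Submodule.smul_mem _ _ (Submodule.mem_span_singleton_self m))
    · intro w hw
      obtain ⟨w₀, hw₀, v, hv, rfl⟩ := Submodule.mem_sup.mp (show w ∈ W ⊔ _ from hw)
      obtain ⟨p, rfl⟩ := Submodule.mem_span_singleton.mp hv
      refine Submodule.add_mem _ (Submodule.mem_sup_left hw₀) ?_
      clear hv hw
      induction p using MvPolynomial.induction_on' with
      | monomial d c =>
        rw [← mul_one c, ← smul_eq_mul, ← smul_monomial, smul_assoc]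
        refine Submodule.smul_mem _ c ?_
        by_cases hd : ↑d.support ⊆ Y
        · exact Submodule.mem_sup_right (Submodule.subset_span ⟨⟨(), d, hd⟩, rfl⟩)
        · obtain ⟨j, hj, hjY⟩ := Set.not_subset.mp hd
          exact Submodule.mem_sup_left
            (monomial_smul_mem_of_single_smul_mem W hj (not_not.mp hjY))
      | add p q hp hq =>
        rw [add_smul]
        exact Submodule.add_mem _ hp hq
  rw [hrestrict] at hsum
  refine hmax _ ⟨_, _, _, hsum.reindex (Fintype.equivFin (Fin r ⊕ Unit)).symm⟩ ?_
  refine SetLike.lt_iff_le_and_exists.mpr ⟨le_sup_left, m, ?_, hm⟩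
  exact Submodule.mem_sup_right (Submodule.mem_span_singleton_self m)

theorem exists_stanleyDecomp_r_eq_slengthMod [Module.Finite (MvPolynomial (Fin n) K) M]
    (g : Multigrading K n M) : ∃ D : StanleyDecomp g, D.r = slengthMod g := by
  obtain ⟨r, x, Z, h⟩ := exists_isStanleyFamily g
  obtain ⟨D, -⟩ := h.exists_stanleyDecomp
  exact Nat.sInf_mem (s := {r | ∃ D : StanleyDecomp g, D.r = r}) ⟨D.r, D, rfl⟩

/-- The image of a Stanley family under an injective degree-preserving map. -/
theorem IsStanleyFamily.map {N : Type} [AddCommGroup N]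
    [Module (MvPolynomial (Fin n) K) N] [Module K N]
    [IsScalarTower K (MvPolynomial (Fin n) K) N]
    {gM : Multigrading K n M} {ι : Type} {x : ι → M}
    {Z : ι → Set (Fin n)} {W : Submodule K M} (h : IsStanleyFamily gM x Z W)
    (gN : Multigrading K n N) (f : M →ₗ[MvPolynomial (Fin n) K] N) (hf : Function.Injective f)
    (hfgr : ∀ (a : Fin n →₀ ℤ) (m : M), m ∈ gM.grading a → f m ∈ gN.grading a) :
    IsStanleyFamily gN (f ∘ x) Z (W.map (f.restrictScalars K)) := by
  have hcomp : stanleyFamily (K := K) (f ∘ x) Z =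
      f.restrictScalars K ∘ stanleyFamily (K := K) x Z := by
    funext p
    simp [stanleyFamily]
  refine ⟨fun i => (h.homog i).imp fun a ha => hfgr a _ ha, ?_, ?_⟩
  · rw [hcomp]
    exact h.linearIndependent.map' _ (LinearMap.ker_eq_bot.mpr hf)
  · rw [hcomp, Set.range_comp, ← Submodule.map_span, h.span_eq]

end StanleyFamilies

/-- If `0 → U → M → N → 0` is a short exact sequence of
finitely generated `ℤⁿ`-graded `S`-modules (with degree-preserving maps), then
`slength(M) ≤ slength(U) + slength(N)`. -/
theorem stmt_0 {K : Type} [Field K] {n : ℕ} {U M N : Type}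
    [AddCommGroup U] [Module (MvPolynomial (Fin n) K) U] [Module K U]
    [IsScalarTower K (MvPolynomial (Fin n) K) U]
    [Module.Finite (MvPolynomial (Fin n) K) U]
    [AddCommGroup M] [Module (MvPolynomial (Fin n) K) M] [Module K M]
    [IsScalarTower K (MvPolynomial (Fin n) K) M]
    [Module.Finite (MvPolynomial (Fin n) K) M]
    [AddCommGroup N] [Module (MvPolynomial (Fin n) K) N] [Module K N]
    [IsScalarTower K (MvPolynomial (Fin n) K) N]
    [Module.Finite (MvPolynomial (Fin n) K) N]
    (gU : Multigrading K n U) (gM : Multigrading K n M) (gN : Multigrading K n N)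
    (f : U →ₗ[MvPolynomial (Fin n) K] M) (g : M →ₗ[MvPolynomial (Fin n) K] N)
    (hf : Function.Injective f) (hg : Function.Surjective g)
    (hexact : LinearMap.range f = LinearMap.ker g)
    (hfgr : ∀ (a : Fin n →₀ ℤ) (x : U), x ∈ gU.grading a → f x ∈ gM.grading a)
    (hggr : ∀ (a : Fin n →₀ ℤ) (x : M), x ∈ gM.grading a → g x ∈ gN.grading a) :
    slengthMod gM ≤ slengthMod gU + slengthMod gN := by
  obtain ⟨DU, hDU⟩ := exists_stanleyDecomp_r_eq_slengthMod gU
  obtain ⟨DN, hDN⟩ := exists_stanleyDecomp_r_eq_slengthMod gN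
  have hlift : ∀ i, ∃ m : M, (∃ a, m ∈ gM.grading a) ∧ g m = DN.elem i := by
    intro i
    obtain ⟨a, ha⟩ := DN.homog i
    obtain ⟨m, hm⟩ := hg (DN.elem i)
    refine ⟨gM.proj a m, ⟨a, gM.proj_mem a m⟩, ?_⟩
    have h := gM.map_proj gN (g.restrictScalars K) hggr a m
    rwa [LinearMap.restrictScalars_apply, LinearMap.restrictScalars_apply, hm,
      gN.proj_of_mem ha] at h
  choose y hy hgy using hlift
  let W : Submodule K M := (⊤ : Submodule K U).map (f.restrictScalars K)
  have hWker : W = LinearMap.ker (g.restrictScalars K) := by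
    ext m
    have hm : m ∈ LinearMap.range f ↔ m ∈ LinearMap.ker g := by rw [hexact]
    simpa [W] using hm
  have hcomp : g.restrictScalars K ∘ stanleyFamily (K := K) y DN.vars =
      stanleyFamily (K := K) DN.elem DN.vars := by
    funext p
    simp [stanleyFamily, hgy]
  have hli : LinearIndependent K (W.mkQ ∘ stanleyFamily (K := K) y DN.vars) := by
    refine LinearIndependent.of_comp (W.liftQ (g.restrictScalars K) hWker.le) ?_
    rw [← Function.comp_assoc, ← LinearMap.coe_comp, Submodule.liftQ_mkQ, hcomp]
    exact DN.isStanleyFamily.linearIndependent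
  have hsum := (DU.isStanleyFamily.map gM f hf hfgr).sumElim hy hli
  have htop : W ⊔ Submodule.span K (Set.range (stanleyFamily (K := K) y DN.vars)) = ⊤ := by
    rw [hWker, sup_comm, ← Submodule.comap_map_eq, Submodule.map_span, ← Set.range_comp, hcomp,
      DN.isStanleyFamily.span_eq, Submodule.comap_top]
  rw [htop] at hsum
  obtain ⟨D, hD⟩ := hsum.exists_stanleyDecomp
  refine Nat.sInf_le ⟨D, ?_⟩
  rw [hD, Fintype.card_sum, Fintype.card_fin, Fintype.card_fin, hDU, hDN]
end

section
/- For any nonzero monomial ideal I ⊂ S, slength(I) ≥ |G(I)|. Moreover, I is a principal ideal if and only if slength(I) = 1. -/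
open MvPolynomial

/-- The set of exponent vectors of the monomials in the Stanley space `x^u · K[Z]`. -/
def stanleySet {σ : Type} (u : σ →₀ ℕ) (Z : Set σ) : Set (σ →₀ ℕ) :=
  {w | ∃ v : σ →₀ ℕ, ↑v.support ⊆ Z ∧ w = u + v}

/-- A Stanley decomposition (partition into Stanley spaces) of a set `P` of
exponent vectors of monomials.  By the standard correspondence, Stanley
decompositions of a multigraded `K`-vector subquotient of `S` spanned by the
monomials with exponents in `P` correspond exactly to such partitions. -/
structure StanleyPartition {σ : Type} (P : Set (σ →₀ ℕ)) where
  r : ℕ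
  base : Fin r → σ →₀ ℕ
  vars : Fin r → Set σ
  cover : P = ⋃ i, stanleySet (base i) (vars i)
  disj : ∀ i j, i ≠ j → Disjoint (stanleySet (base i) (vars i)) (stanleySet (base j) (vars j))

/-- The Stanley length of `P`: the minimal length of a Stanley decomposition. -/
noncomputable def slength {σ : Type} (P : Set (σ →₀ ℕ)) : ℕ :=
  sInf {r | ∃ D : StanleyPartition P, D.r = r}

/-- The set of exponent vectors of the monomials belonging to an ideal. -/
def monSet {σ K : Type} [Field K] (I : Ideal (MvPolynomial σ K)) : Set (σ →₀ ℕ) :=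
  {d | (monomial d (1 : K) : MvPolynomial σ K) ∈ I}

/-- `I` is a monomial ideal. -/
def IsMonomialIdeal {σ K : Type} [Field K] (I : Ideal (MvPolynomial σ K)) : Prop :=
  ∃ A : Set (σ →₀ ℕ), I = Ideal.span ((fun d => (monomial d (1 : K) : MvPolynomial σ K)) '' A)

/-- Exponent vectors of the minimal monomial generators of `I`. -/
def minGens {σ K : Type} [Field K] (I : Ideal (MvPolynomial σ K)) : Set (σ →₀ ℕ) :=
  {d | d ∈ monSet I ∧ ∀ e ∈ monSet I, e ≤ d → e = d}

theorem mem_stanleySet_iff {σ : Type} {u w : σ →₀ ℕ} {Z : Set σ} :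
    w ∈ stanleySet u Z ↔ u ≤ w ∧ ∀ i ∉ Z, w i = u i := by
  constructor
  · rintro ⟨v, hv, rfl⟩
    refine ⟨le_self_add, fun i hi => ?_⟩
    have : v i = 0 := by
      by_contra h
      exact hi (hv (Finsupp.mem_support_iff.2 h))
    simp [this]
  · rintro ⟨hle, h⟩
    refine ⟨w - u, fun i hi => ?_, (add_tsub_cancel_of_le hle).symm⟩
    by_contra hZ
    simp [h i hZ] at hi

theorem self_mem_stanleySet {σ : Type} (u : σ →₀ ℕ) (Z : Set σ) : u ∈ stanleySet u Z :=
  mem_stanleySet_iff.2 ⟨le_rfl, fun _ _ => rfl⟩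

theorem StanleyPartition.base_mem {σ : Type} {P : Set (σ →₀ ℕ)} (D : StanleyPartition P)
    (i : Fin D.r) : D.base i ∈ P :=
  D.cover.ge (Set.mem_iUnion.2 ⟨i, self_mem_stanleySet _ _⟩)

theorem StanleyPartition.exists_base_le {σ : Type} {P : Set (σ →₀ ℕ)} (D : StanleyPartition P)
    {w : σ →₀ ℕ} (hw : w ∈ P) : ∃ i, D.base i ≤ w := by
  rw [D.cover] at hw
  obtain ⟨i, hi⟩ := Set.mem_iUnion.1 hw
  exact ⟨i, (mem_stanleySet_iff.1 hi).1⟩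

/-- If `u ≤ b`, the Stanley space at `u` in the variables where `u` reaches `b` is the fibre over
`u` of the truncation `w ↦ w ⊓ b`. -/
theorem mem_stanleySet_iff_inf_eq {σ : Type} {u b w : σ →₀ ℕ} (hu : u ≤ b) :
    w ∈ stanleySet u {i | b i ≤ u i} ↔ w ⊓ b = u := by
  simp only [mem_stanleySet_iff, Finsupp.ext_iff, Finsupp.inf_apply, Finsupp.le_def,
    Set.mem_ofPred_eq, not_le, ← forall_and]
  refine forall_congr' fun i => ?_
  have := hu i
  omega

theorem exists_bound_inf_mem_of_isUpperSet {σ : Type} [Finite σ] {P : Set (σ →₀ ℕ)}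
    (hP : IsUpperSet P) : ∃ b : σ →₀ ℕ, ∀ w, w ⊓ b ∈ P ↔ w ∈ P := by
  have hfin : {w | Minimal (· ∈ P) w}.Finite :=
    WellQuasiOrderedLE.finite_of_isAntichain (setOfPred_minimal_antichain _)
  obtain ⟨b, hb⟩ := hfin.bddAbove
  refine ⟨b, fun w => ⟨hP inf_le_left, fun hw => ?_⟩⟩
  obtain ⟨m, hmw, hm⟩ := exists_minimal_le_of_wellFoundedLT (· ∈ P) w hw
  exact hP (le_inf hmw (hb hm)) hm.prop

theorem nonempty_stanleyPartition_of_isUpperSet {σ : Type} [Finite σ] {P : Set (σ →₀ ℕ)}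
    (hP : IsUpperSet P) : Nonempty (StanleyPartition P) := by
  classical
  obtain ⟨b, hb⟩ := exists_bound_inf_mem_of_isUpperSet hP
  have hfin : {u | u ∈ P ∧ u ≤ b}.Finite := (Set.finite_Iic b).subset fun _ h => h.2
  have := hfin.to_subtype
  obtain ⟨r, ⟨e⟩⟩ := Finite.exists_equiv_fin {u | u ∈ P ∧ u ≤ b}
  refine ⟨⟨r, fun i => e.symm i, fun i => {j | b j ≤ (e.symm i : σ →₀ ℕ) j}, ?_, ?_⟩⟩
  · ext w
    simp only [Set.mem_iUnion, mem_stanleySet_iff_inf_eq (e.symm _).2.2]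
    constructor
    · intro hw
      exact ⟨e ⟨w ⊓ b, (hb w).2 hw, inf_le_right⟩, by simp⟩
    · rintro ⟨i, hi⟩
      exact (hb w).1 (hi ▸ (e.symm i).2.1)
  · intro i j hij
    refine Set.disjoint_left.2 fun w hi hj => hij (e.symm.injective (Subtype.ext ?_))
    rw [← (mem_stanleySet_iff_inf_eq (e.symm i).2.2).1 hi,
      ← (mem_stanleySet_iff_inf_eq (e.symm j).2.2).1 hj]

theorem exists_stanleyPartition_r_eq_slength {σ : Type} [Finite σ] {P : Set (σ →₀ ℕ)}
    (hP : IsUpperSet P) : ∃ D : StanleyPartition P, D.r = slength P :=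
  Nat.sInf_mem (s := {r | ∃ D : StanleyPartition P, D.r = r})
    ((nonempty_stanleyPartition_of_isUpperSet hP).elim fun D => ⟨D.r, D, rfl⟩)

theorem isUpperSet_monSet {σ K : Type} [Field K] (I : Ideal (MvPolynomial σ K)) :
    IsUpperSet (monSet I) := fun _ _ hab ha =>
  I.mem_of_dvd (monomial_one_dvd_monomial_one.2 hab) ha

theorem IsMonomialIdeal.eq_span_monSet {σ K : Type} [Field K] {I : Ideal (MvPolynomial σ K)}
    (hI : IsMonomialIdeal I) :
    I = Ideal.span ((fun d => (monomial d (1 : K) : MvPolynomial σ K)) '' monSet I) := by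
  apply le_antisymm
  · obtain ⟨A, hA⟩ := hI
    nth_rewrite 1 [hA]
    refine Ideal.span_mono (Set.image_mono fun a ha => ?_)
    change monomial a (1 : K) ∈ I
    rw [hA]
    exact Ideal.subset_span ⟨a, ha, rfl⟩
  · rw [Ideal.span_le]
    rintro _ ⟨d, hd, rfl⟩
    exact hd

theorem IsMonomialIdeal.monSet_nonempty {σ K : Type} [Field K] {I : Ideal (MvPolynomial σ K)}
    (hI : IsMonomialIdeal I) (hne : I ≠ ⊥) : (monSet I).Nonempty := by
  by_contra h
  rw [Set.not_nonempty_iff_eq_empty] at h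
  apply hne
  rw [hI.eq_span_monSet, h]
  simp

/-- A nonzero monomial ideal is principal iff its set of monomials has a least element. -/
theorem IsMonomialIdeal.isPrincipal_iff {σ K : Type} [Field K] {I : Ideal (MvPolynomial σ K)}
    (hI : IsMonomialIdeal I) (hne : I ≠ ⊥) :
    I.IsPrincipal ↔ ∃ u, monSet I = Set.Ici u := by
  constructor
  · rintro ⟨f, hf⟩
    rw [← Ideal.span] at hf
    obtain ⟨d, hd⟩ := hI.monSet_nonempty hne
    change monomial d (1 : K) ∈ I at hd
    rw [hf, Ideal.mem_span_singleton, dvd_monomial_iff_exists one_ne_zero] at hd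
    obtain ⟨u, c, -, hc, rfl⟩ := hd
    refine ⟨u, Set.ext fun w => ?_⟩
    change monomial w (1 : K) ∈ I ↔ u ≤ w
    rw [hf, Ideal.mem_span_singleton, monomial_dvd_monomial]
    simp [ne_zero_of_dvd_ne_zero one_ne_zero hc]
  · rintro ⟨u, hu⟩
    refine ⟨monomial u 1, ?_⟩
    rw [← Ideal.span]
    apply le_antisymm
    · rw [hI.eq_span_monSet, hu, Ideal.span_le]
      rintro _ ⟨d, hd, rfl⟩
      exact Ideal.mem_span_singleton.2 (monomial_one_dvd_monomial_one.2 hd)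
    · rw [Ideal.span_singleton_le_iff_mem]
      exact hu.ge (Set.mem_Ici.2 le_rfl)

theorem slength_eq_one_iff {σ : Type} [Finite σ] {P : Set (σ →₀ ℕ)} (hP : IsUpperSet P) :
    slength P = 1 ↔ ∃ u, P = Set.Ici u := by
  obtain ⟨D, hD⟩ := exists_stanleyPartition_r_eq_slength hP
  constructor
  · intro h
    rw [h] at hD
    have : Subsingleton (Fin D.r) := by rw [hD]; infer_instance
    let i : Fin D.r := ⟨0, by omega⟩
    refine ⟨D.base i, Set.Subset.antisymm (fun w hw => ?_) fun w hw => hP hw (D.base_mem i)⟩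
    obtain ⟨j, hj⟩ := D.exists_base_le hw
    rwa [Subsingleton.elim i j]
  · rintro ⟨u, rfl⟩
    have hle : slength (Set.Ici u) ≤ 1 := by
      refine Nat.sInf_le ⟨⟨1, fun _ => u, fun _ => Set.univ, ?_, fun i j h => ?_⟩, rfl⟩
      · ext w
        simp [mem_stanleySet_iff]
      · exact absurd (Subsingleton.elim i j) h
    obtain ⟨i, -⟩ := D.exists_base_le (Set.mem_Ici.2 (le_refl u))
    have := i.pos
    omega

theorem StanleyPartition.ncard_minGens_le {σ K : Type} [Field K] {I : Ideal (MvPolynomial σ K)}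
    (D : StanleyPartition (monSet I)) : (minGens I).ncard ≤ D.r := by
  have hsub : minGens I ⊆ Set.range D.base := by
    rintro d ⟨hd, hmin⟩
    obtain ⟨i, hi⟩ := D.exists_base_le hd
    exact ⟨i, hmin _ (D.base_mem i) hi⟩
  calc (minGens I).ncard ≤ (Set.range D.base).ncard :=
        Set.ncard_le_ncard hsub (Set.finite_range _)
    _ ≤ D.r := by
        rw [← Set.image_univ]
        exact (Set.ncard_image_le Set.finite_univ).trans (by simp [Set.ncard_univ])

/-- For any nonzero monomial ideal `I ⊂ S`, `slength(I) ≥ |G(I)|`;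
moreover `I` is principal iff `slength(I) = 1`. -/
theorem stmt_1 {K : Type} [Field K] {n : ℕ} (I : Ideal (MvPolynomial (Fin n) K))
    (hmon : IsMonomialIdeal I) (hne : I ≠ ⊥) :
    (minGens I).ncard ≤ slength (monSet I) ∧
      (I.IsPrincipal ↔ slength (monSet I) = 1) := by
  obtain ⟨D, hD⟩ := exists_stanleyPartition_r_eq_slength (isUpperSet_monSet I)
  exact ⟨hD ▸ D.ncard_minGens_le,
    (hmon.isPrincipal_iff hne).trans (slength_eq_one_iff (isUpperSet_monSet I)).symm⟩
end

section
/- Let I ⊂ S be a nonzero monomial ideal and u ∈ S a monomial. Then slength(uI) = slength(I), where uI is the monomial ideal generated by the products u·w for w ∈ I. -/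
open MvPolynomial

theorem stanleySet_add {σ : Type} (u b : σ →₀ ℕ) (Z : Set σ) :
    stanleySet (u + b) Z = (fun d => u + d) '' stanleySet b Z := by
  ext w
  constructor
  · rintro ⟨v, hv, rfl⟩
    exact ⟨b + v, ⟨v, hv, rfl⟩, (add_assoc u b v).symm⟩
  · rintro ⟨_, ⟨v, hv, rfl⟩, rfl⟩
    exact ⟨v, hv, (add_assoc u b v).symm⟩

theorem base_mem_stanleySet {σ : Type} (b : σ →₀ ℕ) (Z : Set σ) : b ∈ stanleySet b Z :=
  ⟨0, by simp, (add_zero b).symm⟩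

/-- Translating a Stanley partition by `u`. -/
noncomputable def StanleyPartition.translate {σ : Type} {P : Set (σ →₀ ℕ)} (D : StanleyPartition P)
    (u : σ →₀ ℕ) : StanleyPartition ((fun d => u + d) '' P) where
  r := D.r
  base i := u + D.base i
  vars := D.vars
  cover := by
    simp only [stanleySet_add, ← Set.image_iUnion, ← D.cover]
  disj i j hij := by
    simp only [stanleySet_add]
    exact Set.disjoint_image_of_injective (add_right_injective u) (D.disj i j hij)

theorem StanleyPartition.exists_of_translate {σ : Type} {P : Set (σ →₀ ℕ)} (u : σ →₀ ℕ)
    (D : StanleyPartition ((fun d => u + d) '' P)) : ∃ D' : StanleyPartition P, D'.r = D.r := by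
  have hbase : ∀ i, ∃ b, u + b = D.base i := fun i => by
    have h : D.base i ∈ (fun d => u + d) '' P :=
      D.cover.symm.subset (Set.mem_iUnion_of_mem i (base_mem_stanleySet _ _))
    obtain ⟨b, -, hb⟩ := h
    exact ⟨b, hb⟩
  choose b hb using hbase
  have hset : ∀ i, stanleySet (D.base i) (D.vars i) =
      (fun d => u + d) '' stanleySet (b i) (D.vars i) := fun i => by
    rw [← hb, stanleySet_add]
  refine ⟨⟨D.r, b, D.vars, ?_, fun i j hij => ?_⟩, rfl⟩
  · apply (add_right_injective u).image_injective
    simpa only [hset, ← Set.image_iUnion] using D.cover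
  · have h := D.disj i j hij
    rw [hset, hset] at h
    exact (Set.disjoint_image_iff (add_right_injective u)).mp h

theorem slength_translate {σ : Type} (u : σ →₀ ℕ) (P : Set (σ →₀ ℕ)) :
    slength ((fun d => u + d) '' P) = slength P := by
  unfold slength
  congr 1
  ext r
  constructor
  · rintro ⟨D, rfl⟩
    exact D.exists_of_translate
  · rintro ⟨D, rfl⟩
    exact ⟨D.translate u, rfl⟩

theorem monSet_span_monomial_mul {σ K : Type} [Field K] (I : Ideal (MvPolynomial σ K))
    (u : σ →₀ ℕ) :
    monSet (Ideal.span {(monomial u (1 : K) : MvPolynomial σ K)} * I) =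
      (fun d => u + d) '' monSet I := by
  ext d
  simp only [monSet, Set.mem_ofPred_eq, Set.mem_image, Ideal.mem_span_singleton_mul]
  constructor
  · rintro ⟨z, hz, h⟩
    have hud : u ≤ d := by
      classical
      by_contra hn
      have hc := congrArg (coeff d) h
      rw [coeff_monomial_mul', if_neg hn, coeff_monomial, if_pos rfl] at hc
      exact zero_ne_one hc
    obtain ⟨e, rfl⟩ := le_iff_exists_add.mp hud
    refine ⟨e, ?_, rfl⟩
    have hmul : monomial u (1 : K) * z = monomial u 1 * monomial e 1 := by
      rw [h, monomial_mul, one_mul]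
    have hu : (monomial u (1 : K) : MvPolynomial σ K) ≠ 0 := by simp
    rwa [← mul_left_cancel₀ hu hmul]
  · rintro ⟨e, he, rfl⟩
    exact ⟨_, he, by rw [monomial_mul, one_mul]⟩


/-- For a nonzero monomial ideal `I` and a monomial `u`,
`slength(uI) = slength(I)`. -/
theorem stmt_2 {K : Type} [Field K] {n : ℕ} (I : Ideal (MvPolynomial (Fin n) K))
    (hmon : IsMonomialIdeal I) (hne : I ≠ ⊥) (u : Fin n →₀ ℕ) :
    slength (monSet (Ideal.span {(monomial u (1 : K) : MvPolynomial (Fin n) K)} * I)) =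
      slength (monSet I) := by
  rw [monSet_span_monomial_mul, slength_translate]
end

section
/- Let I ⊂ S = K[x_1,…,x_n] be a nonzero monomial ideal. Then slength(I·S[x_{n+1}]) = slength(I), where I·S[x_{n+1}] is the extension of I to the polynomial ring S[x_{n+1}] = K[x_1,…,x_n,x_{n+1}]. -/
open MvPolynomial

/-- Restricting exponent vectors along an injection `f` turns a Stanley space into a Stanley space
in which all the variables outside the range of `f` are free. -/
theorem mem_stanleySet_mapDomain_iff {σ τ : Type} {f : σ → τ} (hf : f.Injective)
    {u : σ →₀ ℕ} {Z : Set σ} {w : τ →₀ ℕ} :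
    w ∈ stanleySet (u.mapDomain f) {j | ∀ i, f i = j → i ∈ Z} ↔
      w.comapDomain f hf.injOn ∈ stanleySet u Z := by
  rw [mem_stanleySet_iff, mem_stanleySet_iff]
  constructor
  · rintro ⟨hle, hZ⟩
    refine ⟨fun i => ?_, fun i hi => ?_⟩
    · simpa [Finsupp.mapDomain_apply hf] using hle (f i)
    · simpa [Finsupp.mapDomain_apply hf] using hZ (f i) fun h => hi (h i rfl)
  · rintro ⟨hle, hZ⟩
    refine ⟨fun j => ?_, fun j hj => ?_⟩
    · by_cases h : j ∈ Set.range f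
      · obtain ⟨i, rfl⟩ := h
        simpa [Finsupp.mapDomain_apply hf] using hle i
      · simp [Finsupp.mapDomain_of_notMem_range _ _ h]
    · simp only [Set.mem_ofPred_eq, not_forall] at hj
      obtain ⟨i, rfl, hi⟩ := hj
      simpa [Finsupp.mapDomain_apply hf] using hZ i hi

/-- A Stanley space meets the coordinate subspace spanned by the range of an injection `f` in a
Stanley space, or not at all. -/
theorem mapDomain_mem_stanleySet_iff {σ τ : Type} {f : σ → τ} (hf : f.Injective)
    {u : τ →₀ ℕ} {Z : Set τ} {d : σ →₀ ℕ} :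
    d.mapDomain f ∈ stanleySet u Z ↔
      (∀ j ∉ Set.range f, u j = 0) ∧ d ∈ stanleySet (u.comapDomain f hf.injOn) (f ⁻¹' Z) := by
  rw [mem_stanleySet_iff, mem_stanleySet_iff]
  constructor
  · rintro ⟨hle, hZ⟩
    refine ⟨fun j hj => ?_, fun i => ?_, fun i hi => ?_⟩
    · simpa [Finsupp.mapDomain_of_notMem_range _ _ hj] using hle j
    · simpa [Finsupp.mapDomain_apply hf] using hle (f i)
    · simpa [Finsupp.mapDomain_apply hf] using hZ (f i) hi
  · rintro ⟨h0, hle, hZ⟩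
    refine ⟨fun j => ?_, fun j hj => ?_⟩ <;> by_cases h : j ∈ Set.range f
    · obtain ⟨i, rfl⟩ := h
      simpa [Finsupp.mapDomain_apply hf] using hle i
    · simp [h0 j h]
    · obtain ⟨i, rfl⟩ := h
      simpa [Finsupp.mapDomain_apply hf] using hZ i hj
    · simp [h0 j h, Finsupp.mapDomain_of_notMem_range _ _ h]

/-- Extending the polynomial ring along an injection of variables, a Stanley decomposition extends
to one of the same length. -/
theorem exists_stanleyPartition_preimage_comapDomain {σ τ : Type} {f : σ → τ} (hf : f.Injective)
    {P : Set (σ →₀ ℕ)} (D : StanleyPartition P) :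
    ∃ E : StanleyPartition {w : τ →₀ ℕ | w.comapDomain f hf.injOn ∈ P}, E.r = D.r := by
  refine ⟨⟨D.r, fun k => (D.base k).mapDomain f, fun k => {j | ∀ i, f i = j → i ∈ D.vars k},
    ?_, fun k l hkl => ?_⟩, rfl⟩
  · ext w
    simp only [Set.mem_ofPred_eq, Set.mem_iUnion, mem_stanleySet_mapDomain_iff hf]
    rw [← Set.mem_iUnion, ← D.cover]
  · rw [Set.disjoint_left]
    intro w hk hl
    rw [mem_stanleySet_mapDomain_iff hf] at hk hl
    exact Set.disjoint_left.mp (D.disj k l hkl) hk hl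

/-- A Stanley decomposition over the larger set of variables restricts to one over the smaller set
that is not longer. -/
theorem exists_stanleyPartition_le_of_preimage_comapDomain {σ τ : Type} {f : σ → τ}
    (hf : f.Injective) {P : Set (σ →₀ ℕ)}
    (E : StanleyPartition {w : τ →₀ ℕ | w.comapDomain f hf.injOn ∈ P}) :
    ∃ D : StanleyPartition P, D.r ≤ E.r := by
  classical
  let J := {k : Fin E.r // ∀ j ∉ Set.range f, E.base k j = 0}
  let e : J ≃ Fin (Fintype.card J) := Fintype.equivFin J
  refine ⟨⟨Fintype.card J, fun k => (E.base (e.symm k).1).comapDomain f hf.injOn,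
    fun k => f ⁻¹' E.vars (e.symm k).1, ?_, fun k l hkl => ?_⟩, ?_⟩
  · ext d
    have hd : d ∈ P ↔ ∃ k, d.mapDomain f ∈ stanleySet (E.base k) (E.vars k) := by
      rw [← Set.mem_iUnion, ← E.cover, Set.mem_ofPred_eq, Finsupp.comapDomain_mapDomain f hf]
    rw [hd, Set.mem_iUnion]
    constructor
    · rintro ⟨k, hk⟩
      rw [mapDomain_mem_stanleySet_iff hf] at hk
      exact ⟨e ⟨k, hk.1⟩, by simpa using hk.2⟩
    · rintro ⟨k, hk⟩
      exact ⟨(e.symm k).1, (mapDomain_mem_stanleySet_iff hf).mpr ⟨(e.symm k).2, hk⟩⟩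
  · rw [Set.disjoint_left]
    intro d hk hl
    refine Set.disjoint_left.mp (E.disj (e.symm k).1 (e.symm l).1 fun h =>
      hkl (e.symm.injective (Subtype.ext h)))
      ((mapDomain_mem_stanleySet_iff hf).mpr ⟨(e.symm k).2, hk⟩)
      ((mapDomain_mem_stanleySet_iff hf).mpr ⟨(e.symm l).2, hl⟩)
  · exact (Fintype.card_subtype_le fun k : Fin E.r => ∀ j ∉ Set.range f, E.base k j = 0).trans_eq
      (Fintype.card_fin E.r)

theorem slength_preimage_comapDomain {σ τ : Type} {f : σ → τ} (hf : f.Injective)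
    (P : Set (σ →₀ ℕ)) :
    slength {w : τ →₀ ℕ | w.comapDomain f hf.injOn ∈ P} = slength P := by
  by_cases h : Nonempty (StanleyPartition P)
  · obtain ⟨D₀⟩ := h
    obtain ⟨E₀, -⟩ := exists_stanleyPartition_preimage_comapDomain hf D₀
    apply le_antisymm
    · refine le_csInf ⟨_, D₀, rfl⟩ ?_
      rintro _ ⟨D, rfl⟩
      obtain ⟨E, hE⟩ := exists_stanleyPartition_preimage_comapDomain hf D
      exact Nat.sInf_le ⟨E, hE⟩
    · refine le_csInf ⟨_, E₀, rfl⟩ ?_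
      rintro _ ⟨E, rfl⟩
      obtain ⟨D, hD⟩ := exists_stanleyPartition_le_of_preimage_comapDomain hf E
      exact le_trans (Nat.sInf_le ⟨D, rfl⟩) hD
  · have h' : ¬ Nonempty (StanleyPartition {w : τ →₀ ℕ | w.comapDomain f hf.injOn ∈ P}) :=
      fun h' => h'.elim fun E =>
        h ⟨(exists_stanleyPartition_le_of_preimage_comapDomain hf E).choose⟩
    rw [not_nonempty_iff] at h h'
    simp [slength]

theorem mem_monSet_span_iff {σ K : Type} [Field K] {A : Set (σ →₀ ℕ)} {d : σ →₀ ℕ} :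
    d ∈ monSet (Ideal.span ((fun d => (monomial d (1 : K) : MvPolynomial σ K)) '' A)) ↔
      ∃ a ∈ A, a ≤ d := by
  classical
  rw [monSet, Set.mem_ofPred_eq, mem_ideal_span_monomial_image]
  simp [support_monomial]

theorem mapDomain_le_iff_le_comapDomain {σ τ : Type} {f : σ → τ} (hf : f.Injective)
    {a : σ →₀ ℕ} {w : τ →₀ ℕ} : a.mapDomain f ≤ w ↔ a ≤ w.comapDomain f hf.injOn := by
  constructor
  · intro h i
    simpa [Finsupp.mapDomain_apply hf] using h (f i)
  · intro h j
    by_cases hj : j ∈ Set.range f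
    · obtain ⟨i, rfl⟩ := hj
      simpa [Finsupp.mapDomain_apply hf] using h i
    · simp [Finsupp.mapDomain_of_notMem_range _ _ hj]

theorem monSet_map_rename {σ τ K : Type} [Field K] {f : σ → τ} (hf : f.Injective)
    {I : Ideal (MvPolynomial σ K)} (hI : IsMonomialIdeal I) :
    monSet (Ideal.map (rename f) I : Ideal (MvPolynomial τ K)) =
      {w | w.comapDomain f hf.injOn ∈ monSet I} := by
  obtain ⟨A, rfl⟩ := hI
  have himage : (rename f : MvPolynomial σ K →ₐ[K] MvPolynomial τ K) ''
      ((fun d => monomial d (1 : K)) '' A) =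
        (fun d => monomial d (1 : K)) '' (Finsupp.mapDomain f '' A) := by
    simp only [Set.image_image, rename_monomial]
  ext w
  rw [Ideal.map_span, himage, Set.mem_ofPred_eq, mem_monSet_span_iff, mem_monSet_span_iff,
    Set.exists_mem_image]
  simp only [mapDomain_le_iff_le_comapDomain hf]

/-- For a nonzero monomial ideal `I ⊂ K[x_1,…,x_n]`,
`slength(I·S[x_{n+1}]) = slength(I)`. -/
theorem stmt_4 {K : Type} [Field K] {n : ℕ} (I : Ideal (MvPolynomial (Fin n) K))
    (hmon : IsMonomialIdeal I) (hne : I ≠ ⊥) :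
    slength (monSet (Ideal.map
        (MvPolynomial.rename (Fin.castSucc : Fin n → Fin (n + 1))) I :
      Ideal (MvPolynomial (Fin (n + 1)) K))) = slength (monSet I) := by
  rw [monSet_map_rename (Fin.castSucc_injective n) hmon,
    slength_preimage_comapDomain (Fin.castSucc_injective n)]
end

section
/- Let u ∈ S be a monomial of degree d ≥ 1. Then slength(S/(u)) = d, where (u) is the principal ideal generated by u. -/
open MvPolynomial

/-- A Stanley space containing two exponent vectors that differ in coordinate `j` is closed under
adding multiples of the `j`-th unit vector. -/
theorem add_single_mem_stanleySet {σ : Type} {u w w' : σ →₀ ℕ} {Z : Set σ} {j : σ}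
    (hw : w ∈ stanleySet u Z) (hw' : w' ∈ stanleySet u Z) (hj : w j ≠ w' j) (m : ℕ) :
    w + Finsupp.single j m ∈ stanleySet u Z := by
  rw [mem_stanleySet_iff] at *
  refine ⟨hw.1.trans le_self_add, fun i hi => ?_⟩
  have hij : j ≠ i := by
    rintro rfl
    exact hj ((hw.2 j hi).trans (hw'.2 j hi).symm)
  simp [Finsupp.single_eq_of_ne' hij, hw.2 i hi]

theorem compl_monSet_span_monomial {σ K : Type} [Field K] (a : σ →₀ ℕ) :
    (monSet (Ideal.span {(monomial a (1 : K) : MvPolynomial σ K)}))ᶜ = {w | ¬ a ≤ w} := by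
  ext w
  simp [monSet, Ideal.mem_span_singleton, monomial_dvd_monomial]

/-- The Stanley decomposition of `S/(x^a)` that sorts the monomials `x^w` outside `(x^a)` by the
first index `j` with `w j < a j` and by the value `w j`. -/
noncomputable def firstDeficitPartition {n : ℕ} (a : Fin n →₀ ℕ) :
    StanleyPartition {w | ¬ a ≤ w} where
  r := ∑ j, a j
  base t := Finsupp.equivFunOnFinite.symm fun i =>
    let p := (finSigmaFinEquiv (n := a)).symm t
    if i < p.1 then a i else if i = p.1 then p.2 else 0
  vars t := {((finSigmaFinEquiv (n := a)).symm t).1}ᶜ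
  cover := by
    ext w
    simp only [Set.mem_ofPred_eq, Set.mem_iUnion, mem_stanleySet_iff]
    constructor
    · intro h
      obtain ⟨i, hi⟩ : ∃ i, w i < a i := by simpa [Finsupp.le_def] using h
      obtain ⟨j, hj, hmin⟩ := WellFounded.has_min (wellFounded_lt (α := Fin n))
        {i | w i < a i} ⟨i, hi⟩
      refine ⟨finSigmaFinEquiv ⟨j, ⟨w j, hj⟩⟩, fun i => ?_, fun i hi => ?_⟩
      · simp only [Equiv.symm_apply_apply, Finsupp.equivFunOnFinite_symm_apply_apply]
        split_ifs with h1 h2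
        · exact not_lt.1 fun h => hmin i h h1
        · rw [h2, Equiv.symm_apply_apply]
        · exact Nat.zero_le _
      · simp only [Equiv.symm_apply_apply, Set.mem_compl_iff, Set.mem_singleton_iff,
          not_not] at hi
        subst hi
        simp only [Equiv.symm_apply_apply, Finsupp.equivFunOnFinite_symm_apply_apply, lt_irrefl,
          if_false, if_true]
        rw [Equiv.symm_apply_apply]
    · rintro ⟨t, -, h⟩ hle
      have h1 := h ((finSigmaFinEquiv (n := a)).symm t).1 (by simp)
      simp only [Finsupp.equivFunOnFinite_symm_apply_apply, lt_irrefl, if_false, if_true] at h1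
      have h2 := ((finSigmaFinEquiv (n := a)).symm t).2.2
      have h3 := hle ((finSigmaFinEquiv (n := a)).symm t).1
      omega
  disj s t hst := by
    rw [Set.disjoint_left]
    intro w hs ht
    rw [mem_stanleySet_iff] at hs ht
    apply hst
    apply (finSigmaFinEquiv (n := a)).symm.injective
    generalize (finSigmaFinEquiv (n := a)).symm s = p at *
    generalize (finSigmaFinEquiv (n := a)).symm t = q at *
    obtain ⟨j, k, hk⟩ := p
    obtain ⟨j', k', hk'⟩ := q
    have h1 := hs.2 j (by simp)
    have h2 := ht.2 j' (by simp)
    have h3 := hs.1 j'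
    have h4 := ht.1 j
    simp only [Finsupp.equivFunOnFinite_symm_apply_apply, lt_irrefl, if_false, if_true]
      at h1 h2 h3 h4
    rcases lt_trichotomy j j' with h | rfl | h
    · rw [if_pos h] at h4
      omega
    · obtain rfl : k = k' := h1.symm.trans h2
      rfl
    · rw [if_pos h] at h3
      omega

theorem StanleyPartition.sum_le_r {n : ℕ} {a : Fin n →₀ ℕ}
    (D : StanleyPartition {w | ¬ a ≤ w}) : ∑ j, a j ≤ D.r := by
  classical
  let v : (Σ j, Fin (a j)) → (Fin n →₀ ℕ) := fun p => a.update p.1 p.2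
  have hv : ∀ p, ∃ i, v p ∈ stanleySet (D.base i) (D.vars i) := fun p => by
    have h : v p ∈ {w | ¬ a ≤ w} := fun hle => by
      have h1 := hle p.1
      have h2 := p.2.2
      simp only [v, Finsupp.coe_update, Function.update_self] at h1
      omega
    rw [D.cover] at h
    simpa using h
  choose f hf using hv
  have hf_inj : Function.Injective f := fun p q hpq => by
    by_contra hne
    have hdiff : v p p.1 ≠ v q p.1 := by
      obtain ⟨j, k⟩ := p
      obtain ⟨j', k'⟩ := q
      by_cases h : j = j'
      · subst h
        intro h
        simp only [v, Finsupp.coe_update, Function.update_self] at h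
        exact hne (by rw [Fin.ext h])
      · simp only [v, Finsupp.coe_update, Function.update_self, Function.update_of_ne h]
        exact k.2.ne
    have hmem := add_single_mem_stanleySet (hf p) (hpq ▸ hf q) hdiff (a p.1)
    have h : v p + Finsupp.single p.1 (a p.1) ∈ {w | ¬ a ≤ w} := by
      rw [D.cover]
      exact Set.mem_iUnion.2 ⟨_, hmem⟩
    refine h fun i => ?_
    by_cases hi : i = p.1
    · subst hi
      simp
    · simp [v, Function.update_of_ne hi]
  simpa using Fintype.card_le_of_injective f hf_inj

/-- For a monomial `u` of degree `d ≥ 1`, `slength(S/(u)) = d`. -/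
theorem stmt_6 {K : Type} [Field K] {n : ℕ} (a : Fin n →₀ ℕ) (d : ℕ)
    (hd : 1 ≤ d) (hdeg : ∑ j, a j = d) :
    slength ((monSet (Ideal.span
        {(monomial a (1 : K) : MvPolynomial (Fin n) K)}))ᶜ) = d := by
  subst hdeg
  rw [compl_monSet_span_monomial]
  refine le_antisymm (Nat.sInf_le ⟨firstDeficitPartition a, rfl⟩)
    (le_csInf ⟨_, firstDeficitPartition a, rfl⟩ ?_)
  rintro _ ⟨D, rfl⟩
  exact D.sum_le_r
end
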